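/- Let 0 < a, b < c with 2ab < c ≤ a+b < c + 1/2. Then the function f(r) = √(1−r²)·𝕂_{a,b,c}(r) is strictly decreasing on [0,1), with f(0) = B(a,b)/2 and f(r) → 0 as r → 1−. -/

import Mathlib

open Filter Set

/-- Shifted factorial (Appell symbol) `(a,n) = a(a+1)⋯(a+n−1)`, with `(a,0)=1`. -/
noncomputable def shiftedFact (a : ℝ) (n : ℕ) : ℝ := ∏ i ∈ Finset.range n, (a + i)

/-- Gaussian hypergeometric function `F(a,b;c;x)` as a real power series. -/
noncomputable def hypF (a b c x : ℝ) : ℝ :=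
  ∑' n : ℕ, (shiftedFact a n * shiftedFact b n / (shiftedFact c n * (n.factorial : ℝ))) * x ^ n

/-- Beta function `B(x,y) = Γ(x)Γ(y)/Γ(x+y)`. -/
noncomputable def betaR (x y : ℝ) : ℝ := Real.Gamma x * Real.Gamma y / Real.Gamma (x + y)

/-- Generalized complete elliptic integral of the first kind `𝕂_{a,b,c}(r)`. -/
noncomputable def Kg (a b c r : ℝ) : ℝ := betaR a b / 2 * hypF a b c (r ^ 2)

/-- Generalized complete elliptic integral of the second kind `𝔼_{a,b,c}(r)`. -/
noncomputable def Eg (a b c r : ℝ) : ℝ := betaR a b / 2 * hypF (a - 1) b c (r ^ 2)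

lemma shiftedFact_succ (a : ℝ) (n : ℕ) : shiftedFact a (n + 1) = shiftedFact a n * (a + n) :=
  Finset.prod_range_succ _ _

lemma shiftedFact_pos {a : ℝ} (ha : 0 < a) (n : ℕ) : 0 < shiftedFact a n :=
  Finset.prod_pos fun _ _ => by positivity

/-- The coefficient of `x ^ n` in `hypF a b c x`. -/
noncomputable def hypCoeff (a b c : ℝ) (n : ℕ) : ℝ :=
  shiftedFact a n * shiftedFact b n / (shiftedFact c n * (n.factorial : ℝ))

lemma hypF_eq_tsum (a b c x : ℝ) : hypF a b c x = ∑' n, hypCoeff a b c n * x ^ n := rfl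

lemma hypCoeff_zero (a b c : ℝ) : hypCoeff a b c 0 = 1 := by
  simp [hypCoeff, shiftedFact]

section

variable {a b c : ℝ}

lemma hypCoeff_pos (ha : 0 < a) (hb : 0 < b) (hc : 0 < c) (n : ℕ) : 0 < hypCoeff a b c n := by
  have := shiftedFact_pos ha n
  have := shiftedFact_pos hb n
  have := shiftedFact_pos hc n
  unfold hypCoeff
  positivity

lemma succ_mul_hypCoeff_succ (hc : 0 < c) (n : ℕ) :
    (n + 1) * hypCoeff a b c (n + 1) = hypCoeff a b c n * ((a + n) * (b + n) / (c + n)) := by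
  have := (shiftedFact_pos hc n).ne'
  have : c + n ≠ 0 := by positivity
  simp only [hypCoeff, shiftedFact_succ, Nat.factorial_succ]
  push_cast
  field_simp

/-- If `a * b ≤ θ * c` and `a + b - c ≤ θ`, the coefficients of `(1 - x) * F'` are at most `θ`
times those of `F`. -/
lemma succ_mul_hypCoeff_succ_le (ha : 0 < a) (hb : 0 < b) (hc : 0 < c) {θ : ℝ}
    (hθ₁ : a * b ≤ θ * c) (hθ₂ : a + b - c ≤ θ) (n : ℕ) :
    (n + 1) * hypCoeff a b c (n + 1) ≤ (n + θ) * hypCoeff a b c n := by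
  rw [succ_mul_hypCoeff_succ hc, mul_comm]
  refine mul_le_mul_of_nonneg_right ?_ (hypCoeff_pos ha hb hc n).le
  rw [div_le_iff₀ (by positivity)]
  nlinarith [mul_le_mul_of_nonneg_right hθ₂ (Nat.cast_nonneg (α := ℝ) n)]

lemma hypCoeff_le_one (ha : 0 < a) (hb : 0 < b) (hc : 0 < c)
    (h₁ : a * b ≤ c) (h₂ : a + b ≤ c + 1) (n : ℕ) : hypCoeff a b c n ≤ 1 := by
  induction n with
  | zero => exact (hypCoeff_zero a b c).le
  | succ n ih =>
    have h := succ_mul_hypCoeff_succ_le ha hb hc (θ := 1) (by linarith) (by linarith) n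
    exact (le_of_mul_le_mul_left h (by positivity)).trans ih

lemma summable_mul_pow_of_nonneg_of_le_one {u : ℕ → ℝ} (h0 : ∀ n, 0 ≤ u n) (h1 : ∀ n, u n ≤ 1)
    {x : ℝ} (hx : |x| < 1) : Summable fun n => u n * x ^ n := by
  refine Summable.of_norm_bounded (summable_geometric_of_lt_one (abs_nonneg x) hx) fun n => ?_
  rw [norm_mul, norm_pow, Real.norm_eq_abs, Real.norm_eq_abs, abs_of_nonneg (h0 n)]
  exact mul_le_of_le_one_left (by positivity) (h1 n)

lemma summable_natCast_mul_pow_pred {x : ℝ} (hx : |x| < 1) :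
    Summable fun n : ℕ => (n : ℝ) * x ^ (n - 1) := by
  rw [← summable_nat_add_iff 1]
  have h₁ := summable_pow_mul_geometric_of_norm_lt_one 1 (r := x) hx
  have h₀ := summable_geometric_of_norm_lt_one (x := x) hx
  refine (h₁.add h₀).congr fun n => ?_
  push_cast
  simp
  ring

lemma summable_mul_natCast_mul_pow_pred {u : ℕ → ℝ} (h0 : ∀ n, 0 ≤ u n) (h1 : ∀ n, u n ≤ 1)
    {x : ℝ} (hx : |x| < 1) : Summable fun n : ℕ => u n * (n * x ^ (n - 1)) := by
  refine Summable.of_norm_bounded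
    (summable_natCast_mul_pow_pred (x := |x|) (by rwa [abs_abs])) fun n => ?_
  rw [norm_mul, norm_mul, norm_pow, Real.norm_eq_abs, Real.norm_eq_abs, Real.norm_eq_abs,
    abs_of_nonneg (h0 n), Nat.abs_cast]
  exact mul_le_of_le_one_left (by positivity) (h1 n)

lemma hasDerivAt_tsum_mul_pow {u : ℕ → ℝ} (h0 : ∀ n, 0 ≤ u n) (h1 : ∀ n, u n ≤ 1)
    {x : ℝ} (hx : |x| < 1) :
    HasDerivAt (fun y => ∑' n, u n * y ^ n) (∑' n : ℕ, u n * (n * x ^ (n - 1))) x := by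
  obtain ⟨ρ, hxρ, hρ⟩ := exists_between hx
  have hρ0 : 0 < ρ := (abs_nonneg x).trans_lt hxρ
  refine hasDerivAt_tsum_of_isPreconnected (t := Metric.ball (0 : ℝ) ρ) (y₀ := 0)
    (summable_natCast_mul_pow_pred (x := ρ) (by rwa [abs_of_pos hρ0]))
    Metric.isOpen_ball (convex_ball _ _).isPreconnected
    (fun n y _ => (hasDerivAt_pow n y).const_mul (u n)) (fun n y hy => ?_)
    (Metric.mem_ball_self hρ0)
    (summable_mul_pow_of_nonneg_of_le_one h0 h1 (by simp)) (by simpa using hxρ)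
  have hy' : |y| ≤ ρ := by simpa using (Metric.mem_ball.1 hy).le
  rw [norm_mul, norm_mul, norm_pow, Real.norm_eq_abs, Real.norm_eq_abs, Real.norm_eq_abs,
    abs_of_nonneg (h0 n), Nat.abs_cast]
  calc u n * (n * |y| ^ (n - 1)) ≤ n * |y| ^ (n - 1) :=
        mul_le_of_le_one_left (by positivity) (h1 n)
    _ ≤ n * ρ ^ (n - 1) := by gcongr

/-- A power series whose coefficients satisfy `(n + 1) uₙ₊₁ ≤ (n + θ) uₙ` satisfies the
differential inequality `(1 - x) F' ≤ θ F`. -/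
lemma one_sub_mul_tsum_deriv_le {u : ℕ → ℝ} (h0 : ∀ n, 0 ≤ u n) (h1 : ∀ n, u n ≤ 1) {θ : ℝ}
    (hu : ∀ n : ℕ, (n + 1) * u (n + 1) ≤ (n + θ) * u n) {x : ℝ} (hx0 : 0 ≤ x) (hx1 : x < 1) :
    (1 - x) * ∑' n : ℕ, u n * (n * x ^ (n - 1)) ≤ θ * ∑' n, u n * x ^ n := by
  have hx : |x| < 1 := by rwa [abs_of_nonneg hx0]
  have hd := summable_mul_natCast_mul_pow_pred h0 h1 hx
  have hs := summable_mul_pow_of_nonneg_of_le_one h0 h1 hx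
  have key : ∑' n : ℕ, u n * (n * x ^ (n - 1)) ≤
      ∑' n : ℕ, (x * (u n * (n * x ^ (n - 1))) + θ * (u n * x ^ n)) := by
    rw [hd.tsum_eq_zero_add]
    simp only [Nat.cast_zero, zero_mul, mul_zero, zero_add]
    refine ((summable_nat_add_iff 1).2 hd).tsum_le_tsum (fun n => ?_)
      ((hd.mul_left x).add (hs.mul_left θ))
    have hn : x * (u n * (n * x ^ (n - 1))) = n * u n * x ^ n := by
      rcases n with _ | n
      · simp
      · rw [Nat.add_sub_cancel, pow_succ]; ring
    rw [hn, Nat.add_sub_cancel]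
    push_cast
    nlinarith [mul_le_mul_of_nonneg_right (hu n) (pow_nonneg hx0 n)]
  rw [(hd.mul_left x).tsum_add (hs.mul_left θ), tsum_mul_left, tsum_mul_left] at key
  linarith

/-- Under the hypotheses of `one_sub_mul_tsum_deriv_le`, `(1 - x) ^ θ * F x` is antitone. -/
lemma antitoneOn_one_sub_rpow_mul_tsum {u : ℕ → ℝ} (h0 : ∀ n, 0 ≤ u n) (h1 : ∀ n, u n ≤ 1)
    {θ : ℝ} (hu : ∀ n : ℕ, (n + 1) * u (n + 1) ≤ (n + θ) * u n) :
    AntitoneOn (fun x : ℝ => (1 - x) ^ θ * ∑' n, u n * x ^ n) (Ico 0 1) := by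
  have hder : ∀ x ∈ Ico (0 : ℝ) 1, HasDerivAt (fun x : ℝ => (1 - x) ^ θ * ∑' n, u n * x ^ n)
      (-1 * θ * (1 - x) ^ (θ - 1) * ∑' n, u n * x ^ n +
        (1 - x) ^ θ * ∑' n : ℕ, u n * (n * x ^ (n - 1))) x := fun x hx =>
    (((hasDerivAt_id x).const_sub 1).rpow_const (Or.inl (sub_pos.2 hx.2).ne')).mul
      (hasDerivAt_tsum_mul_pow h0 h1 (by rw [abs_of_nonneg hx.1]; exact hx.2))
  refine antitoneOn_of_deriv_nonpos (convex_Ico 0 1)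
    (fun x hx => (hder x hx).continuousAt.continuousWithinAt)
    (fun x hx => (hder x (interior_subset hx)).differentiableAt.differentiableWithinAt)
    fun x hx => ?_
  replace hx := interior_subset hx
  have hpos : 0 < 1 - x := sub_pos.2 hx.2
  rw [(hder x hx).deriv]
  have hrpow : (1 - x) ^ θ = (1 - x) ^ (θ - 1) * (1 - x) := by
    rw [Real.rpow_sub_one hpos.ne', div_mul_cancel₀ _ hpos.ne']
  rw [hrpow]
  nlinarith [mul_le_mul_of_nonneg_left (one_sub_mul_tsum_deriv_le h0 h1 hu hx.1 hx.2)
    (Real.rpow_nonneg hpos.le (θ - 1))]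

lemma one_le_hypF (ha : 0 < a) (hb : 0 < b) (hc : 0 < c) (h₁ : a * b ≤ c) (h₂ : a + b ≤ c + 1)
    {x : ℝ} (hx0 : 0 ≤ x) (hx1 : x < 1) : 1 ≤ hypF a b c x := by
  have hpos := fun n => (hypCoeff_pos ha hb hc n).le
  have hs := summable_mul_pow_of_nonneg_of_le_one hpos (hypCoeff_le_one ha hb hc h₁ h₂)
    (x := x) (by rwa [abs_of_nonneg hx0])
  have := hs.le_tsum 0 fun n _ => mul_nonneg (hpos n) (pow_nonneg hx0 n)
  rwa [pow_zero, mul_one, hypCoeff_zero] at this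

lemma hypF_zero (a b c : ℝ) : hypF a b c 0 = 1 := by
  rw [hypF_eq_tsum, tsum_eq_single 0 fun n hn => by simp [hn]]
  simp [hypCoeff_zero]

lemma betaR_pos (ha : 0 < a) (hb : 0 < b) : 0 < betaR a b :=
  div_pos (mul_pos (Real.Gamma_pos_of_pos ha) (Real.Gamma_pos_of_pos hb))
    (Real.Gamma_pos_of_pos (add_pos ha hb))

/-- The exponent `1 / 2` leaves room for some `δ > 0`: `(1 - x) ^ (1 / 2 - δ) * F x` is still
antitone. -/
lemma exists_antitoneOn_one_sub_rpow_mul_hypF (ha : 0 < a) (hb : 0 < b) (hc : 0 < c)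
    (h₁ : 2 * a * b < c) (h₂ : a + b < c + 1 / 2) :
    ∃ δ > (0 : ℝ), AntitoneOn (fun x : ℝ => (1 - x) ^ (1 / 2 - δ : ℝ) * hypF a b c x) (Ico 0 1) := by
  have h₁' : a * b / c < 1 / 2 := by rw [div_lt_iff₀ hc]; linarith
  refine ⟨1 / 2 - max (a * b / c) (a + b - c), sub_pos.2 (max_lt h₁' (by linarith)), ?_⟩
  rw [sub_sub_cancel]
  have hab : 0 < a * b := mul_pos ha hb
  exact antitoneOn_one_sub_rpow_mul_tsum (fun n => (hypCoeff_pos ha hb hc n).le)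
    (hypCoeff_le_one ha hb hc (by linarith) (by linarith))
    (succ_mul_hypCoeff_succ_le ha hb hc ((div_le_iff₀ hc).1 (le_max_left _ _)) (le_max_right _ _))

end

theorem stmt18 (a b c : ℝ) (ha : 0 < a) (hb : 0 < b) (hac : a < c) (hbc : b < c)
    (h1 : 2 * a * b < c) (h2 : c ≤ a + b) (h3 : a + b < c + 1 / 2)
    (f : ℝ → ℝ)
    (hf : ∀ r, f r = Real.sqrt (1 - r ^ 2) * Kg a b c r) :
    StrictAntiOn f (Set.Ico 0 1) ∧ f 0 = betaR a b / 2 ∧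
    Tendsto f (nhdsWithin 1 (Set.Iio 1)) (nhds 0) := by
  have hc : 0 < c := ha.trans hac
  have hab : 0 < a * b := mul_pos ha hb
  have hβ : 0 < betaR a b / 2 := half_pos (betaR_pos ha hb)
  obtain ⟨δ, hδ, hanti⟩ := exists_antitoneOn_one_sub_rpow_mul_hypF ha hb hc h1 h3
  set h : ℝ → ℝ := fun x => (1 - x) ^ (1 / 2 - δ) * hypF a b c x with hh
  have hsq : ∀ r ∈ Ico (0 : ℝ) 1, r ^ 2 ∈ Ico (0 : ℝ) 1 := fun r hr =>
    ⟨sq_nonneg r, by nlinarith [hr.1, hr.2]⟩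
  have hpos : ∀ x ∈ Ico (0 : ℝ) 1, 0 < h x := fun x hx =>
    mul_pos (Real.rpow_pos_of_pos (sub_pos.2 hx.2) _)
      (one_pos.trans_le (one_le_hypF ha hb hc (by linarith) (by linarith) hx.1 hx.2))
  have hfac : ∀ r ∈ Ico (0 : ℝ) 1, f r = betaR a b / 2 * ((1 - r ^ 2) ^ δ * h (r ^ 2)) := by
    intro r hr
    have hr' : 0 < 1 - r ^ 2 := sub_pos.2 (hsq r hr).2
    rw [hf, Kg, Real.sqrt_eq_rpow, hh]
    have : (1 - r ^ 2) ^ (1 / 2 : ℝ) = (1 - r ^ 2) ^ δ * (1 - r ^ 2) ^ (1 / 2 - δ) := by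
      rw [← Real.rpow_add hr']; ring_nf
    rw [this]
    ring
  refine ⟨fun r hr s hs hrs => ?_, by simp [hf, Kg, hypF_zero], ?_⟩
  · rw [hfac r hr, hfac s hs]
    have hrs2 : r ^ 2 < s ^ 2 := pow_lt_pow_left₀ hrs hr.1 two_ne_zero
    refine mul_lt_mul_of_pos_left (mul_lt_mul ?_ (hanti (hsq r hr) (hsq s hs) hrs2.le)
      (hpos _ (hsq s hs)) (Real.rpow_nonneg (sub_pos.2 (hsq r hr).2).le _)) hβ
    exact Real.rpow_lt_rpow (sub_pos.2 (hsq s hs).2).le (by linarith) hδ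
  · have hnear : ∀ᶠ r in nhdsWithin (1 : ℝ) (Iio 1), r ∈ Ico (0 : ℝ) 1 :=
      Ico_mem_nhdsLT zero_lt_one
    have hbound : Tendsto (fun r : ℝ => betaR a b / 2 * (1 - r ^ 2) ^ δ)
        (nhdsWithin 1 (Iio 1)) (nhds 0) := by
      have hcont : Continuous fun r : ℝ => betaR a b / 2 * (1 - r ^ 2) ^ δ :=
        continuous_const.mul
          ((continuous_const.sub (continuous_pow 2)).rpow_const fun _ => Or.inr hδ.le)
      have := (hcont.tendsto 1).mono_left (nhdsWithin_le_nhds (s := Iio 1))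
      simpa [Real.zero_rpow hδ.ne'] using this
    refine squeeze_zero' (hnear.mono fun r hr => ?_) (hnear.mono fun r hr => ?_) hbound
    · have := hpos _ (hsq r hr)
      have := Real.rpow_nonneg (sub_pos.2 (hsq r hr).2).le δ
      rw [hfac r hr]
      positivity
    · have h01 : h (r ^ 2) ≤ 1 := by
        have := hanti (left_mem_Ico.2 one_pos) (hsq r hr) (hsq r hr).1
        simpa [hh, hypF_zero] using this
      rw [hfac r hr]
      exact mul_le_mul_of_nonneg_left (mul_le_of_le_one_right
        (Real.rpow_nonneg (sub_pos.2 (hsq r hr).2).le δ) h01) hβ.le
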